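/- Let D ≥ 2 and n ≥ 1 be integers, let Ξ = ∏_{i=1}^{D} [α_i, β_i] with α_i < β_i, and let f : ℝ^D → ℝ be C^∞ on Ξ and satisfy the derivative bound: there exist C_f ≥ 0, γ_f > 0 and an integer σ ≥ 1 such that for all x ∈ Ξ, all 1 ≤ i ≤ D and all integers v ≥ 0, |∂_i^v f(x)| ≤ C_f·(v+σ−1)!/(γ_f^v·(σ−1)!). Let M(i_1,…,i_D) = f(η^{(1)}_{i_1},…,η^{(D)}_{i_D}) be the tensor of samples of f at the grid of n scaled Chebyshev nodes per dimension. Then for every integer p with 1 ≤ p ≤ n there exist natural numbers r_0 = r_D = 1 and r_k ≤ min{p^k, p^{D−k}} for 1 ≤ k ≤ D−1, and tensor-train cores G_k : {1,…,r_{k−1}} × {1,…,n} × {1,…,r_k} → ℝ for k = 1,…,D, such that the tensor M̂ with entries M̂(i_1,…,i_D) = Σ_{s_1=1}^{r_1} ⋯ Σ_{s_{D−1}=1}^{r_{D−1}} G_1(1,i_1,s_1)·G_2(s_1,i_2,s_2)⋯G_D(s_{D−1},i_D,1) satisfies max over all multi-indices i of |M(i) − M̂(i)| ≤ E(p) whenever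 p < n, and M̂ = M exactly (zero error) when p = n. -/

import Mathlib

open Real Finset

/-- Chebyshev polynomial of the first kind of degree `m`, evaluated at `x`. -/
noncomputable def chebT (m : ℕ) (x : ℝ) : ℝ :=
  (Polynomial.Chebyshev.T ℝ m).eval x

/-- The Chebyshev nodes of the first kind in `[-1,1]` (indexed by `Fin n`, so that
index `k` corresponds to the node `cos((2(k+1)−1)π/(2n)) = cos((2k+1)π/(2n))`). -/
noncomputable def chebNode (n : ℕ) (k : Fin n) : ℝ :=
  Real.cos ((2 * (k : ℝ) + 1) * Real.pi / (2 * (n : ℝ)))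

/-- The scaled Chebyshev node on `[α, β]`: `η_k = ((α−β)/2)·ζ_k + (α+β)/2`. -/
noncomputable def scaledChebNode (n : ℕ) (α β : ℝ) (k : Fin n) : ℝ :=
  ((α - β) / 2) * chebNode n k + (α + β) / 2

/-- The Lebesgue constant `λ_{n−1}` of the `n` Chebyshev nodes:
`sup_{x ∈ [−1,1]} Σ_{k=1}^n ∏_{j≠k} |x − ζ_j| / |ζ_k − ζ_j|`. -/
noncomputable def lebesgueConst (n : ℕ) : ℝ :=
  ⨆ x ∈ Set.Icc (-1 : ℝ) 1,
    ∑ k : Fin n, ∏ j ∈ Finset.univ.erase k,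
      |x - chebNode n j| / |chebNode n k - chebNode n j|

/-- `ς(r) = r + √(1 + r²)`. -/
noncomputable def varsigma (r : ℝ) : ℝ := r + Real.sqrt (1 + r ^ 2)

/-- The error quantity
`E(k) = 2·e·D·C_f·(λ_{k−1}+1)^D·(k+1)^σ·(1 + diam/γ_f)·ς(2γ_f/diam)^{−k}`. -/
noncomputable def Equant (D : ℕ) (Cf γf diam : ℝ) (σ : ℕ) (k : ℕ) : ℝ :=
  2 * Real.exp 1 * (D : ℝ) * Cf * (lebesgueConst k + 1) ^ D * ((k : ℝ) + 1) ^ σ *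
    (1 + diam / γf) * (varsigma (2 * γf / diam))⁻¹ ^ k

/-- Partial evaluation of a tensor-train: given ranks `r` (with `r 0 = 1`),
cores `G k` of size `r k × n × r (k+1)` and a multi-index `i`, `ttVec r G i k`
is the row vector obtained by contracting the first `k` cores at indices
`i 0, …, i (k−1)`. -/
noncomputable def ttVec {n : ℕ} (r : ℕ → ℕ)
    (G : ∀ k : ℕ, Fin (r k) → Fin n → Fin (r (k + 1)) → ℝ)
    (i : ℕ → Fin n) : (k : ℕ) → Fin (r k) → ℝ
  | 0, _ => 1
  | (k + 1), t => ∑ s : Fin (r k), ttVec r G i k s * G k s (i k) t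

/-- The entry of the order-`D` tensor represented in tensor-train format by
ranks `r` (with `r 0 = r D = 1`) and cores `G`:
`M̂(i) = Σ_{s_1,…,s_{D−1}} G_1(1,i_1,s_1)·G_2(s_1,i_2,s_2)⋯G_D(s_{D−1},i_D,1)`. -/
noncomputable def ttEntry {n : ℕ} (r : ℕ → ℕ)
    (G : ∀ k : ℕ, Fin (r k) → Fin n → Fin (r (k + 1)) → ℝ)
    (D : ℕ) (i : ℕ → Fin n) : ℝ :=
  ∑ t : Fin (r D), ttVec r G i D t

/-- The contraction of the tensor `T` with the vectors `U d (i d)` in the `m` modes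
`k, …, k + m - 1`; the other modes are read off from `x`. -/
noncomputable def tuckerContract {n : ℕ} (p : ℕ) (U : ℕ → Fin n → ℕ → ℝ) (i : ℕ → Fin n)
    (T : (ℕ → ℕ) → ℝ) : ℕ → ℕ → (ℕ → ℕ) → ℝ
  | 0, _, x => T x
  | m + 1, k, x =>
    ∑ j ∈ range p, U k (i k) j * tuckerContract p U i T m (k + 1) (Function.update x k j)

/-- The multi-index whose first `k` entries are the base-`p` digits of `s`, most significant
digit first. -/
def digitPrefix (p : ℕ) : ℕ → ℕ → ℕ → ℕ
  | 0, _ => 0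
  | k + 1, s => Function.update (digitPrefix p k (s / p)) k (s % p)

/-- The multi-index `x` with entries `k, …, k + m - 1` replaced by the base-`p` digits of `s`,
least significant digit first. -/
def digitSuffix (p : ℕ) : ℕ → ℕ → ℕ → (ℕ → ℕ) → ℕ → ℕ
  | 0, _, _, x => x
  | m + 1, k, s, x => digitSuffix p m (k + 1) (s / p) (Function.update x k (s % p))

/-- The product of the weights selected in the modes `k, …, k + m - 1` by the base-`p` digits of
`s`, least significant digit first. -/
noncomputable def suffixWeight {n : ℕ} (p : ℕ) (U : ℕ → Fin n → ℕ → ℝ) (i : ℕ → Fin n) :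
    ℕ → ℕ → ℕ → ℝ
  | 0, _, _ => 1
  | m + 1, k, s => U k (i k) (s % p) * suffixWeight p U i m (k + 1) (s / p)

lemma sum_range_mul_digit (p q : ℕ) (F : ℕ → ℝ) :
    ∑ s ∈ range (p * q), F s = ∑ j ∈ range p, ∑ t ∈ range q, F (j + p * t) := by
  rw [sum_comm]
  induction q with
  | zero => simp
  | succ q ih =>
    rw [mul_add, mul_one, sum_range_add, ih, sum_range_succ]
    simp only [add_comm]

lemma sum_suffixWeight_mul {n : ℕ} (p : ℕ) (U : ℕ → Fin n → ℕ → ℝ) (i : ℕ → Fin n)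
    (T : (ℕ → ℕ) → ℝ) (m k : ℕ) (x : ℕ → ℕ) :
    ∑ s ∈ range (p ^ m), T (digitSuffix p m k s x) * suffixWeight p U i m k s =
      tuckerContract p U i T m k x := by
  induction m generalizing k x with
  | zero => simp [digitSuffix, suffixWeight, tuckerContract]
  | succ m ih =>
    rw [pow_succ', sum_range_mul_digit, tuckerContract]
    refine sum_congr rfl fun j hj => ?_
    have hj : j < p := by simpa using hj
    rw [← ih, mul_sum]
    refine sum_congr rfl fun t _ => ?_
    have h1 : (j + p * t) / p = t := by
      rw [Nat.add_mul_div_left _ _ (by omega), Nat.div_eq_of_lt hj, zero_add]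
    have h2 : (j + p * t) % p = j := by
      rw [Nat.add_mul_mod_self_left, Nat.mod_eq_of_lt hj]
    simp only [digitSuffix, suffixWeight, h1, h2]
    ring

/-- Tensor-train evaluation by backward contraction: `R k` is the contraction of the cores
`k, …, D - 1`. -/
lemma ttEntry_eq_of_backward {n : ℕ} (r : ℕ → ℕ)
    (G : ∀ k : ℕ, Fin (r k) → Fin n → Fin (r (k + 1)) → ℝ) (D : ℕ) (i : ℕ → Fin n)
    (R : ∀ k, Fin (r k) → ℝ) (hD : ∀ t, R D t = 1)
    (hR : ∀ k < D, ∀ s, R k s = ∑ t, G k s (i k) t * R (k + 1) t) :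
    ttEntry r G D i = ∑ s, R 0 s := by
  have key : ∀ k ≤ D, ∑ t, ttVec r G i k t * R k t = ∑ s, R 0 s := by
    intro k
    induction k with
    | zero => intro _; simp [ttVec]
    | succ k ih =>
      intro hk
      rw [← ih (by omega)]
      simp only [ttVec, sum_mul]
      rw [sum_comm]
      refine sum_congr rfl fun s _ => ?_
      rw [hR k (by omega) s, mul_sum]
      exact sum_congr rfl fun t _ => by ring
  rw [← key D le_rfl]
  simp [ttEntry, hD]

/-- A tensor in Tucker format with core of mode size `p` has a tensor-train decomposition with
ranks at most `min (p ^ k) (p ^ (D - k))`. -/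
lemma exists_tt_of_tucker {n : ℕ} (D p : ℕ) (hD : 2 ≤ D) (hp : 1 ≤ p)
    (U : ℕ → Fin n → ℕ → ℝ) (T : (ℕ → ℕ) → ℝ) :
    ∃ r : ℕ → ℕ, r 0 = 1 ∧ r D = 1 ∧
      (∀ k, 1 ≤ k → k ≤ D - 1 → r k ≤ min (p ^ k) (p ^ (D - k))) ∧
      ∃ G : ∀ k : ℕ, Fin (r k) → Fin n → Fin (r (k + 1)) → ℝ,
        ∀ i : ℕ → Fin n, ttEntry r G D i = tuckerContract p U i T D 0 0 := by
  obtain ⟨m, hm⟩ : ∃ m, m = D / 2 := ⟨_, rfl⟩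
  let r : ℕ → ℕ := fun k => if k ≤ m then p ^ k else p ^ (D - k)
  have hr1 : ∀ k, k ≤ m → r k = p ^ k := fun k hk => if_pos hk
  have hr2 : ∀ k, m < k → r k = p ^ (D - k) := fun k hk => if_neg (by omega)
  let g : ℕ → ℕ → Fin n → ℕ → ℝ := fun k s a t =>
    if k < m then (if t / p = s then U k a (t % p) else 0)
    else if k = m then ∑ j ∈ range p, U k a j *
      T (digitSuffix p (D - (k + 1)) (k + 1) t (Function.update (digitPrefix p k s) k j))
    else (if s / p = t then U k a (s % p) else 0)
  refine ⟨r, by simp [r], by rw [hr2 D (by omega)]; simp, ?_,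
    fun k s a t => g k s a t, fun i => ?_⟩
  · intro k hk1 hk2
    rcases le_or_gt k m with h | h
    · rw [hr1 k h]
      exact le_min le_rfl (Nat.pow_le_pow_right hp (by omega))
    · rw [hr2 k h]
      exact le_min (Nat.pow_le_pow_right hp (by omega)) le_rfl
  let R : ℕ → ℕ → ℝ := fun k s =>
    if k ≤ m then tuckerContract p U i T (D - k) k (digitPrefix p k s)
    else suffixWeight p U i (D - k) k s
  rw [ttEntry_eq_of_backward r _ D i (fun k s => R k s)]
  · have : ∀ s : Fin (r 0), R 0 s = tuckerContract p U i T D 0 0 := fun s => by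
      simp only [R, if_pos (Nat.zero_le m), digitPrefix, Nat.sub_zero]
    simp only [this, sum_const, card_univ, Fintype.card_fin, hr1 0 (Nat.zero_le m), pow_zero,
      one_smul]
  · intro t
    have : ¬ D ≤ m := by omega
    simp [R, this, suffixWeight]
  · intro k hk s
    rw [Fin.sum_univ_eq_sum_range (fun t => g k s (i k) t * R (k + 1) t) (r (k + 1))]
    obtain ⟨e, he⟩ : ∃ e, D = k + 1 + e := ⟨D - (k + 1), by omega⟩
    have he1 : D - k = e + 1 := by omega
    have he2 : D - (k + 1) = e := by omega
    rcases lt_trichotomy k m with h | h | h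
    · have hs : (s : ℕ) < p ^ k := s.2.trans_eq (hr1 k h.le)
      rw [hr1 (k + 1) h, pow_succ', sum_range_mul_digit]
      simp only [R, g, if_pos h, if_pos h.le, if_pos (Nat.succ_le_of_lt h), he1, he2,
        tuckerContract]
      refine sum_congr rfl fun j hj => ?_
      have hj : j < p := by simpa using hj
      rw [sum_eq_single_of_mem (s : ℕ) (by simpa using hs)]
      · have h1 : (j + p * s) / p = s := by
          rw [Nat.add_mul_div_left _ _ (by omega), Nat.div_eq_of_lt hj, zero_add]
        have h2 : (j + p * s) % p = j := by
          rw [Nat.add_mul_mod_self_left, Nat.mod_eq_of_lt hj]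
        simp [h1, h2, digitPrefix]
      · intro t _ hts
        have h1 : (j + p * t) / p = t := by
          rw [Nat.add_mul_div_left _ _ (by omega), Nat.div_eq_of_lt hj, zero_add]
        simp [h1, hts]
    · rw [hr2 (k + 1) (by omega)]
      simp only [R, g, if_neg (show ¬ k < m by omega), if_pos h, if_pos h.le,
        if_neg (show ¬ k + 1 ≤ m by omega), he1, he2, tuckerContract, sum_mul]
      rw [sum_comm]
      refine sum_congr rfl fun j _ => ?_
      rw [← sum_suffixWeight_mul, mul_sum]
      exact sum_congr rfl fun t _ => by ring
    · have hs : (s : ℕ) < p * p ^ e := s.2.trans_eq (by rw [hr2 k h, he1, pow_succ'])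
      rw [hr2 (k + 1) (by omega), he2]
      simp only [R, g, if_neg (show ¬ k < m by omega), if_neg (show k ≠ m by omega),
        if_neg (show ¬ k ≤ m by omega), if_neg (show ¬ k + 1 ≤ m by omega), he1, he2,
        suffixWeight]
      rw [sum_eq_single_of_mem ((s : ℕ) / p)
        (mem_range.2 (Nat.div_lt_of_lt_mul hs))]
      · simp
      · intro t _ hts
        simp [hts.symm]

/-- The Chebyshev nodes of the first kind, indexed by natural numbers. -/
noncomputable def chebNodeNat (p j : ℕ) : ℝ :=
  Real.cos ((2 * (j : ℝ) + 1) * Real.pi / (2 * (p : ℝ)))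

lemma chebNodeNat_mem (p j : ℕ) : chebNodeNat p j ∈ Set.Icc (-1 : ℝ) 1 :=
  ⟨Real.neg_one_le_cos _, Real.cos_le_one _⟩

lemma injOn_chebNodeNat (p : ℕ) : Set.InjOn (chebNodeNat p) (range p : Finset ℕ) := by
  intro a ha b hb h
  have ha : a < p := by simpa using ha
  have hb : b < p := by simpa using hb
  have hp : (0 : ℝ) < p := by exact_mod_cast (Nat.zero_le a).trans_lt ha
  have mem : ∀ c : ℕ, c < p → (2 * (c : ℝ) + 1) * Real.pi / (2 * (p : ℝ)) ∈ Set.Icc 0 Real.pi := by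
    intro c hc
    have hc' : (c : ℝ) + 1 ≤ p := by exact_mod_cast hc
    refine ⟨by positivity, ?_⟩
    rw [div_le_iff₀ (by positivity)]
    nlinarith [Real.pi_pos]
  have := Real.injOn_cos (mem a ha) (mem b hb) h
  field_simp at this
  exact_mod_cast (by linarith : (a : ℝ) = b)

/-- The Lagrange basis polynomial for the Chebyshev nodes. -/
noncomputable def chebBasis (p j : ℕ) : Polynomial ℝ :=
  Lagrange.basis (range p) (chebNodeNat p) j

lemma eval_chebBasis_chebNodeNat {p i j : ℕ} (hi : i < p) (hj : j < p) :
    (chebBasis p j).eval (chebNodeNat p i) = if j = i then 1 else 0 := by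
  split_ifs with h
  · subst h
    exact Lagrange.eval_basis_self (injOn_chebNodeNat p) (by simpa using hj)
  · exact Lagrange.eval_basis_of_ne h (by simpa using hi)

lemma sum_abs_eval_chebBasis (p : ℕ) (x : ℝ) :
    ∑ j ∈ range p, |(chebBasis p j).eval x| =
      ∑ k : Fin p, ∏ j ∈ Finset.univ.erase k,
        |x - chebNode p j| / |chebNode p k - chebNode p j| := by
  rw [← Fin.sum_univ_eq_sum_range (fun j => |(chebBasis p j).eval x|)]
  refine sum_congr rfl fun k _ => ?_
  rw [chebBasis, Lagrange.basis, Polynomial.eval_prod, abs_prod]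
  symm
  refine prod_nbij (fun j => (j : ℕ)) ?_ ?_ ?_ ?_
  · intro j hj
    simp only [mem_erase, mem_univ, and_true, mem_range] at hj ⊢
    exact ⟨fun h => hj (Fin.ext h), j.2⟩
  · exact fun a _ b _ h => Fin.ext h
  · intro j hj
    simp only [coe_erase, coe_range, Set.mem_sdiff, Set.mem_Iio, Set.mem_singleton_iff] at hj
    exact ⟨⟨j, hj.1⟩, by simpa [Fin.ext_iff] using hj.2, rfl⟩
  · intro j _
    simp only [Lagrange.basisDivisor, Polynomial.eval_mul, Polynomial.eval_C, Polynomial.eval_sub,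
      Polynomial.eval_X, abs_mul, abs_inv, chebNodeNat, chebNode]
    exact (div_eq_mul_inv _ _).trans (mul_comm _ _)

lemma sum_abs_eval_chebBasis_le (p : ℕ) {x : ℝ} (hx : x ∈ Set.Icc (-1 : ℝ) 1) :
    ∑ j ∈ range p, |(chebBasis p j).eval x| ≤ lebesgueConst p := by
  have hcont : Continuous fun x => ∑ j ∈ range p, |(chebBasis p j).eval x| := by fun_prop
  obtain ⟨B, hB⟩ := (isCompact_Icc (a := (-1 : ℝ)) (b := 1)).bddAbove_image hcont.continuousOn
  have hB' : ∀ y ∈ Set.Icc (-1 : ℝ) 1, ∑ j ∈ range p, |(chebBasis p j).eval y| ≤ B :=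
    fun y hy => hB ⟨y, hy, rfl⟩
  have hB0 : 0 ≤ B := (sum_nonneg fun _ _ => abs_nonneg _).trans (hB' x hx)
  unfold lebesgueConst
  simp only [← sum_abs_eval_chebBasis]
  refine le_ciSup_of_le ⟨B, ?_⟩ x ?_
  · rintro _ ⟨y, rfl⟩
    exact Real.iSup_le (fun hy => hB' y hy) hB0
  · exact le_ciSup_of_le ⟨_, by rintro _ ⟨_, rfl⟩; exact le_rfl⟩ hx le_rfl

lemma lebesgueConst_nonneg (p : ℕ) : 0 ≤ lebesgueConst p :=
  (sum_nonneg fun _ _ => abs_nonneg _).trans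
    (sum_abs_eval_chebBasis_le p (x := 0) (by norm_num))

/-- Chebyshev interpolation is quasi-optimal. -/
lemma abs_sub_chebInterpolate_le (p : ℕ) (g : ℝ → ℝ) (q : Polynomial ℝ) (hq : q.degree < p)
    {ε : ℝ} (hqg : ∀ x ∈ Set.Icc (-1 : ℝ) 1, |g x - q.eval x| ≤ ε)
    {x : ℝ} (hx : x ∈ Set.Icc (-1 : ℝ) 1) :
    |g x - ∑ j ∈ range p, (chebBasis p j).eval x * g (chebNodeNat p j)| ≤
      (lebesgueConst p + 1) * ε := by
  have hε : 0 ≤ ε := (abs_nonneg _).trans (hqg x hx)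
  have h1 : q.eval x =
      ∑ j ∈ range p, (chebBasis p j).eval x * q.eval (chebNodeNat p j) := by
    conv_lhs => rw [Lagrange.eq_interpolate (injOn_chebNodeNat p)
      (by simpa using hq : q.degree < _)]
    rw [Lagrange.interpolate_apply, Polynomial.eval_finsetSum]
    exact sum_congr rfl fun j _ => by
      rw [Polynomial.eval_mul, Polynomial.eval_C, mul_comm, chebBasis]
  have h2 : g x - ∑ j ∈ range p, (chebBasis p j).eval x * g (chebNodeNat p j) =
      (g x - q.eval x) - ∑ j ∈ range p, (chebBasis p j).eval x *
        (g (chebNodeNat p j) - q.eval (chebNodeNat p j)) := by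
    simp only [mul_sub, sum_sub_distrib]
    rw [← h1]
    ring
  rw [h2]
  refine (abs_sub _ _).trans ?_
  have h3 : |∑ j ∈ range p, (chebBasis p j).eval x *
        (g (chebNodeNat p j) - q.eval (chebNodeNat p j))| ≤ lebesgueConst p * ε := by
    refine (abs_sum_le_sum_abs _ _).trans ?_
    refine le_trans ?_ (mul_le_mul_of_nonneg_right (sum_abs_eval_chebBasis_le p hx) hε)
    rw [sum_mul]
    refine sum_le_sum fun j _ => ?_
    rw [abs_mul]
    exact mul_le_mul_of_nonneg_left (hqg _ (chebNodeNat_mem p j)) (abs_nonneg _)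
  linarith [hqg x hx]

/-- The almost holomorphic extension of `x ↦ g 0 (cos x)` by Taylor polynomials of degree `N`,
where `g v` is the `v`-th derivative of `g 0`. -/
noncomputable def taylorCos (g : ℕ → ℝ → ℝ) (N : ℕ) (z : ℂ) : ℂ :=
  ∑ v ∈ range (N + 1), ((g v (Real.cos z.re) : ℝ) : ℂ) / (v.factorial : ℂ) *
    (Complex.cos z - Complex.cos (z.re : ℂ)) ^ v

lemma hasFDerivAt_comp_re {h : ℝ → ℝ} {h' : ℝ} {z : ℂ} (hh : HasDerivAt h h' z.re) :
    HasFDerivAt (fun z : ℂ => (h z.re : ℂ))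
      ((h' : ℂ) • (Complex.ofRealCLM.comp Complex.reCLM)) z := by
  have h1 := (hh.ofReal_comp.hasFDerivAt).comp z Complex.reCLM.hasFDerivAt
  refine h1.congr_fderiv ?_
  ext; simp [mul_comm]

lemma hasFDerivAt_taylorCos (g : ℕ → ℝ → ℝ)
    (hg : ∀ v, ∀ x ∈ Set.Icc (-1 : ℝ) 1,
      HasDerivWithinAt (g v) (g (v + 1) x) (Set.Icc (-1) 1) x) (N : ℕ) (z : ℂ) :
    HasFDerivAt (taylorCos g N)
      ((-((g (N + 1) (Real.cos z.re) : ℝ) : ℂ) * (Real.sin z.re : ℂ) / (N.factorial : ℂ) *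
          (Complex.cos z - Complex.cos (z.re : ℂ)) ^ N) •
            (Complex.ofRealCLM.comp Complex.reCLM) +
        (-Complex.sin z * ∑ v ∈ range N, ((g (v + 1) (Real.cos z.re) : ℝ) : ℂ) /
          (v.factorial : ℂ) * (Complex.cos z - Complex.cos (z.re : ℂ)) ^ v) •
            (ContinuousLinearMap.id ℝ ℂ)) z := by
  have hgc : ∀ v, HasFDerivAt (fun z : ℂ => ((g v (Real.cos z.re) : ℝ) : ℂ))
      (((g (v + 1) (Real.cos z.re) * (-Real.sin z.re) : ℝ) : ℂ) •
        (Complex.ofRealCLM.comp Complex.reCLM)) z := fun v => by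
    have h1 := (hg v _ (Real.cos_mem_Icc z.re)).comp z.re
      (Real.hasDerivAt_cos z.re).hasDerivWithinAt (s := Set.univ) (fun x _ => Real.cos_mem_Icc x)
    exact hasFDerivAt_comp_re (h := fun x => g v (Real.cos x)) (hasDerivWithinAt_univ.1 h1)
  have hd : HasFDerivAt (fun z : ℂ => Complex.cos z - Complex.cos (z.re : ℂ))
      ((-Complex.sin z) • (ContinuousLinearMap.id ℝ ℂ) +
        (Complex.sin (z.re : ℂ)) • (Complex.ofRealCLM.comp Complex.reCLM)) z := by
    have h1 : HasFDerivAt Complex.cos ((-Complex.sin z) • (ContinuousLinearMap.id ℝ ℂ)) z := by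
      refine ((Complex.hasDerivAt_cos z).hasFDerivAt.restrictScalars ℝ).congr_fderiv ?_
      ext; simp [mul_comm]
    have h2 := hasFDerivAt_comp_re (Real.hasDerivAt_cos z.re)
    simp only [Complex.ofReal_cos] at h2
    refine (h1.sub h2).congr_fderiv ?_
    ext; simp
  induction N with
  | zero =>
    have h0 : taylorCos g 0 = fun z : ℂ => ((g 0 (Real.cos z.re) : ℝ) : ℂ) := by
      funext z; simp [taylorCos]
    rw [h0]
    refine (hgc 0).congr_fderiv ?_
    ext; simp
  | succ N ih =>
    have h0 : taylorCos g (N + 1) = fun z => taylorCos g N z +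
        ((g (N + 1) (Real.cos z.re) : ℝ) : ℂ) * (((N + 1).factorial : ℂ)⁻¹ *
          (Complex.cos z - Complex.cos (z.re : ℂ)) ^ (N + 1)) := by
      funext z
      rw [taylorCos, sum_range_succ, ← taylorCos]
      ring
    rw [h0]
    refine (ih.add ((hgc (N + 1)).mul ((hd.pow (N + 1)).const_mul _))).congr_fderiv ?_
    have hN : (N.factorial : ℂ) ≠ 0 := by exact_mod_cast N.factorial_ne_zero
    have hN1 : (N : ℂ) + 1 ≠ 0 := by exact_mod_cast N.succ_ne_zero
    refine ContinuousLinearMap.ext fun w => ?_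
    simp only [sum_range_succ, Nat.factorial_succ, Nat.cast_mul, Nat.cast_succ,
      add_apply, smul_apply, smul_eq_mul,
      ContinuousLinearMap.comp_apply, Complex.ofRealCLM_apply, Complex.reCLM_apply,
      ContinuousLinearMap.id_apply, Complex.ofReal_mul, Complex.ofReal_neg,
      Complex.ofReal_sin, add_tsub_cancel_right, nsmul_eq_mul]
    field_simp
    ring

lemma norm_cos_sub_cos_re_le (z : ℂ) :
    ‖Complex.cos z - Complex.cos (z.re : ℂ)‖ ≤ Real.sinh |z.im| := by
  have hs : 0 ≤ Real.sinh |z.im| := Real.sinh_nonneg_iff.2 (abs_nonneg _)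
  have h1 : Complex.cos z - Complex.cos (z.re : ℂ) =
      ((Real.cos z.re * (Real.cosh z.im - 1) : ℝ) : ℂ) +
        ((-(Real.sin z.re * Real.sinh z.im) : ℝ) : ℂ) * Complex.I := by
    conv_lhs => rw [← Complex.re_add_im z]
    rw [Complex.cos_add_mul_I]
    push_cast
    simp
    ring
  rw [h1, ← abs_of_nonneg hs, ← Real.sqrt_sq_eq_abs, Complex.norm_add_mul_I]
  refine Real.sqrt_le_sqrt ?_
  have h2 : Real.sinh |z.im| ^ 2 = Real.sinh z.im ^ 2 := by
    rcases abs_choice z.im with h | h <;> simp [h]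
  rw [h2]
  have h3 := Real.cosh_sq z.im
  have h4 := Real.one_le_cosh z.im
  have h5 := Real.sin_sq_add_cos_sq z.re
  have h6 : (Real.cosh z.im - 1) ^ 2 ≤ Real.sinh z.im ^ 2 := by nlinarith
  nlinarith [sq_nonneg (Real.cos z.re), mul_le_mul_of_nonneg_left h6 (sq_nonneg (Real.cos z.re))]

/-- Bounds `|g v| ≤ C (v + k)! / (k! r ^ v)` on `[-1, 1]` for a function `g 0` whose `v`-th
derivative is `g v`. -/
structure IsAnalyticJet (g : ℕ → ℝ → ℝ) (C r : ℝ) (k : ℕ) : Prop where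
  hasDeriv : ∀ v, ∀ x ∈ Set.Icc (-1 : ℝ) 1,
    HasDerivWithinAt (g v) (g (v + 1) x) (Set.Icc (-1) 1) x
  bound : ∀ v, ∀ x ∈ Set.Icc (-1 : ℝ) 1,
    |g v x| ≤ C * (((v + k).choose k : ℝ) * v.factorial) / r ^ v

lemma IsAnalyticJet.continuous_comp_cos {g : ℕ → ℝ → ℝ} {C r : ℝ} {k : ℕ}
    (hg : IsAnalyticJet g C r k) (v : ℕ) : Continuous fun x => g v (Real.cos x) :=
  ContinuousOn.comp_continuous (fun x hx => (hg.hasDeriv v x hx).continuousWithinAt)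
    Real.continuous_cos Real.cos_mem_Icc

lemma IsAnalyticJet.norm_taylorCos_le {g : ℕ → ℝ → ℝ} {C r : ℝ} {k : ℕ}
    (hg : IsAnalyticJet g C r k) (hC : 0 ≤ C) {s : ℝ} (hs : 0 ≤ s) (hsr : s < r) (N : ℕ)
    {z : ℂ} (hz : Real.sinh |z.im| ≤ s) :
    ‖taylorCos g N z‖ ≤ C * (1 / (1 - s / r) ^ (k + 1)) := by
  have hr : 0 < r := hs.trans_lt hsr
  have hq : ‖s / r‖ < 1 := by
    rw [Real.norm_of_nonneg (by positivity)]
    exact (div_lt_one hr).2 hsr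
  have hsum := hasSum_choose_mul_geometric_of_norm_lt_one k hq
  refine (norm_sum_le _ _).trans ?_
  refine le_trans ?_ (mul_le_mul_of_nonneg_left
    (sum_le_hasSum (range (N + 1)) (fun v _ => by positivity) hsum) hC)
  rw [mul_sum]
  refine sum_le_sum fun v _ => ?_
  have hv : (0 : ℝ) < v.factorial := by exact_mod_cast v.factorial_pos
  rw [norm_mul, norm_div, norm_pow, Complex.norm_real, Complex.norm_natCast, Real.norm_eq_abs]
  calc |g v (Real.cos z.re)| / v.factorial * ‖Complex.cos z - Complex.cos (z.re : ℂ)‖ ^ v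
      ≤ C * (((v + k).choose k : ℝ) * v.factorial) / r ^ v / v.factorial * s ^ v := by
        gcongr
        · exact hg.bound v _ (Real.cos_mem_Icc _)
        · exact (norm_cos_sub_cos_re_le z).trans hz
    _ = C * (((v + k).choose k : ℝ) * (s / r) ^ v) := by
        rw [div_pow]
        field_simp

lemma IsAnalyticJet.norm_remainder_le {g : ℕ → ℝ → ℝ} {C r : ℝ} {k : ℕ}
    (hg : IsAnalyticJet g C r k) (hC : 0 ≤ C) {s : ℝ} (hs : 0 ≤ s) (hsr : s < r) (N : ℕ)
    {z : ℂ} (hz : Real.sinh |z.im| ≤ s) :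
    ‖-((g (N + 1) (Real.cos z.re) : ℝ) : ℂ) * (Real.sin z.re : ℂ) / (N.factorial : ℂ) *
      (Complex.cos z - Complex.cos (z.re : ℂ)) ^ N‖ ≤
      C * (k + 1) / r * (((N + (k + 1)).choose (k + 1) : ℝ) * (s / r) ^ N) := by
  have hr : 0 < r := hs.trans_lt hsr
  have hv : (0 : ℝ) < N.factorial := by exact_mod_cast N.factorial_pos
  have hch : (((N + 1 + k).choose k : ℝ)) * (N + 1) =
      ((N + (k + 1)).choose (k + 1) : ℝ) * (k + 1) := by
    have := Nat.choose_succ_right_eq (N + 1 + k) k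
    rw [show N + 1 + k - k = N + 1 by omega] at this
    rw [show N + (k + 1) = N + 1 + k by omega]
    exact_mod_cast this.symm
  rw [norm_mul, norm_div, norm_mul, norm_neg, norm_pow, Complex.norm_real, Complex.norm_real,
    Complex.norm_natCast, Real.norm_eq_abs, Real.norm_eq_abs]
  calc |g (N + 1) (Real.cos z.re)| * |Real.sin z.re| / N.factorial *
        ‖Complex.cos z - Complex.cos (z.re : ℂ)‖ ^ N
      ≤ C * (((N + 1 + k).choose k : ℝ) * (N + 1).factorial) / r ^ (N + 1) * 1 / N.factorial *
          s ^ N := by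
        gcongr
        · exact hg.bound (N + 1) _ (Real.cos_mem_Icc _)
        · exact Real.abs_sin_le_one _
        · exact (norm_cos_sub_cos_re_le z).trans hz
    _ = C * (((N + 1 + k).choose k : ℝ) * (N + 1)) * s ^ N / r ^ (N + 1) := by
        rw [Nat.factorial_succ]
        push_cast
        field_simp
    _ = _ := by
        rw [hch, div_pow, pow_succ]
        field_simp

/-- Shifting the contour of the `m`-th Fourier integral of `x ↦ g 0 (cos x)` by `a` into the
complex plane. -/
lemma IsAnalyticJet.norm_integral_le_of_shift {g : ℕ → ℝ → ℝ} {C r : ℝ} {k : ℕ}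
    (hg : IsAnalyticJet g C r k) (hC : 0 ≤ C) (a : ℝ) (har : Real.sinh |a| < r) (m : ℤ) :
    ‖∫ x in (0 : ℝ)..2 * Real.pi,
        Complex.exp (-Complex.I * m * x) * ((g 0 (Real.cos x) : ℝ) : ℂ)‖ ≤
      2 * Real.pi * (C * (1 / (1 - Real.sinh |a| / r) ^ (k + 1)) * Real.exp (m * a)) := by
  have hpi : (0 : ℝ) < 2 * Real.pi := by positivity
  obtain ⟨s, hs_def⟩ : ∃ s, s = Real.sinh |a| := ⟨_, rfl⟩
  rw [← hs_def] at har ⊢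
  have hs : 0 ≤ s := hs_def ▸ Real.sinh_nonneg_iff.2 (abs_nonneg _)
  have hr : 0 < r := hs.trans_lt har
  have hcos : ∀ z : ℂ, |z.im| ≤ |a| → Real.sinh |z.im| ≤ s := fun z hz =>
    hs_def ▸ Real.sinh_le_sinh.2 hz
  have hnexp : ∀ z : ℂ, ‖Complex.exp (-Complex.I * m * z)‖ = Real.exp (m * z.im) := by
    intro z
    rw [Complex.norm_exp]
    simp
  let e : ℂ → ℂ := fun z => Complex.exp (-Complex.I * m * z)
  let ρ : ℕ → ℂ → ℂ := fun N z =>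
    -((g (N + 1) (Real.cos z.re) : ℝ) : ℂ) * (Real.sin z.re : ℂ) / (N.factorial : ℂ) *
      (Complex.cos z - Complex.cos (z.re : ℂ)) ^ N
  let H : ℕ → ℂ → ℂ := fun N z => e z * taylorCos g N z
  have hder : ∀ N z, ∃ L : ℂ →L[ℝ] ℂ, HasFDerivAt (H N) L z ∧
      Complex.I • L 1 - L Complex.I = Complex.I * (e z * ρ N z) := by
    intro N z
    have he : HasDerivAt e (e z * (-Complex.I * m)) z := by
      have := ((hasDerivAt_id z).const_mul (-Complex.I * (m : ℂ))).cexp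
      simpa [e] using this
    have h := (he.hasFDerivAt.restrictScalars ℝ).mul (hasFDerivAt_taylorCos g hg.hasDeriv N z)
    refine ⟨_, h, ?_⟩
    simp [ρ]
    ring
  choose L hL hLI using hder
  have hcont : ∀ N, Continuous (H N) := fun N =>
    continuous_iff_continuousAt.2 fun z => (hL N z).continuousAt
  have hρcont : ∀ N, Continuous (ρ N) := fun N => by
    have h1 : Continuous fun z : ℂ => ((g (N + 1) (Real.cos z.re) : ℝ) : ℂ) :=
      Complex.continuous_ofReal.comp ((hg.continuous_comp_cos (N + 1)).comp Complex.continuous_re)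
    fun_prop
  have hrect : ∀ N, (∫ x in (0 : ℝ)..2 * Real.pi, H N x) -
      (∫ x in (0 : ℝ)..2 * Real.pi, H N (x + a * Complex.I)) =
      ∫ x in (0 : ℝ)..2 * Real.pi, ∫ y in (0 : ℝ)..a,
        Complex.I * (e (x + y * Complex.I) * ρ N (x + y * Complex.I)) := by
    intro N
    have h := Complex.integral_boundary_rect_of_hasFDerivAt_real_off_countable (H N) (L N)
      0 ((2 * Real.pi : ℝ) + a * Complex.I) ∅ Set.countable_empty (hcont N).continuousOn
      (fun x _ => hL N x) (by
        simp only [hLI]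
        refine ContinuousOn.integrableOn_compact
          (isCompact_uIcc.reProdIm isCompact_uIcc) (Continuous.continuousOn ?_)
        have := hρcont N
        fun_prop)
    have hper : ∀ y : ℝ, H N (2 * (Real.pi : ℂ) + y * Complex.I) = H N (y * Complex.I) := by
      intro y
      have h1 : e (2 * (Real.pi : ℂ) + y * Complex.I) = e (y * Complex.I) := by
        simp only [e]
        rw [Complex.exp_eq_exp_iff_exists_int]
        refine ⟨-m, ?_⟩
        push_cast
        ring
      have h2 : taylorCos g N (2 * (Real.pi : ℂ) + y * Complex.I) =
          taylorCos g N (y * Complex.I) := by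
        have h3 : Complex.cos (2 * (Real.pi : ℂ) + y * Complex.I) =
            Complex.cos (y * Complex.I) := by
          rw [add_comm]; exact Complex.cos_add_two_pi _
        simp only [taylorCos, h3]
        simp
      simp only [H, h1, h2]
    simp only [hLI] at h
    simpa [hper] using h
  have hI0 : ∀ N, (∫ x in (0 : ℝ)..2 * Real.pi, H N x) = ∫ x in (0 : ℝ)..2 * Real.pi,
        Complex.exp (-Complex.I * m * x) * ((g 0 (Real.cos x) : ℝ) : ℂ) := by
    intro N
    congr 1
    funext x
    simp only [H, e, taylorCos, Complex.ofReal_re, sub_self]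
    rw [sum_range_succ', sum_eq_zero (fun v _ => by simp)]
    simp
  have htop : ∀ N, ‖∫ x in (0 : ℝ)..2 * Real.pi, H N (x + a * Complex.I)‖ ≤
      2 * Real.pi * (C * (1 / (1 - s / r) ^ (k + 1)) * Real.exp (m * a)) := by
    intro N
    have h := intervalIntegral.norm_integral_le_of_norm_le_const (a := (0 : ℝ)) (b := 2 * Real.pi)
      (f := fun x : ℝ => H N (x + a * Complex.I))
      (C := C * (1 / (1 - s / r) ^ (k + 1)) * Real.exp (m * a)) (fun x _ => by
        rw [norm_mul, hnexp, mul_comm]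
        have h1 : ((x : ℂ) + a * Complex.I).im = a := by simp
        rw [h1]
        exact mul_le_mul_of_nonneg_right
          (hg.norm_taylorCos_le hC hs har N (hcos _ (by rw [h1]))) (Real.exp_pos _).le)
    rw [sub_zero, abs_of_pos hpi] at h
    linarith
  let δ : ℕ → ℝ := fun N => 2 * Real.pi * (|a| * (Real.exp (|(m : ℝ)| * |a|) *
    (C * (k + 1) / r * (((N + (k + 1)).choose (k + 1) : ℝ) * (s / r) ^ N))))
  have hrem : ∀ N, ‖∫ x in (0 : ℝ)..2 * Real.pi, ∫ y in (0 : ℝ)..a,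
        Complex.I * (e (x + y * Complex.I) * ρ N (x + y * Complex.I))‖ ≤ δ N := by
    intro N
    have h := intervalIntegral.norm_integral_le_of_norm_le_const (a := (0 : ℝ)) (b := 2 * Real.pi)
      (f := fun x : ℝ => ∫ y in (0 : ℝ)..a,
        Complex.I * (e (x + y * Complex.I) * ρ N (x + y * Complex.I)))
      (C := (Real.exp (|(m : ℝ)| * |a|) * (C * (k + 1) / r *
        (((N + (k + 1)).choose (k + 1) : ℝ) * (s / r) ^ N))) * |a - 0|)
      (fun x _ => intervalIntegral.norm_integral_le_of_norm_le_const fun y hy => by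
        have h1 : ((x : ℂ) + y * Complex.I).im = y := by simp
        have hy' : |y| ≤ |a| := by
          rcases Set.mem_uIoc.1 hy with ⟨h0, h1⟩ | ⟨h0, h1⟩
          · rw [abs_of_pos h0, abs_of_pos (h0.trans_le h1)]; exact h1
          · rw [abs_of_nonpos h1, abs_of_neg (h0.trans_le h1)]; linarith
        rw [norm_mul, Complex.norm_I, one_mul, norm_mul, hnexp, h1]
        refine mul_le_mul (Real.exp_le_exp.2 ?_)
          (hg.norm_remainder_le hC hs har N (hcos _ (by rw [h1]; exact hy')))
          (norm_nonneg _) (Real.exp_pos _).le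
        exact (le_abs_self _).trans (by rw [abs_mul]; gcongr))
    refine h.trans_eq ?_
    rw [sub_zero, sub_zero, abs_of_pos hpi]
    simp only [δ]
    ring
  have hδ : Filter.Tendsto δ Filter.atTop (nhds 0) := by
    have hq : ‖s / r‖ < 1 := by
      rw [Real.norm_of_nonneg (by positivity)]
      exact (div_lt_one hr).2 har
    have := (hasSum_choose_mul_geometric_of_norm_lt_one (k + 1) hq).summable.tendsto_atTop_zero
    have := ((((this.const_mul (C * (k + 1) / r)).const_mul
      (Real.exp (|(m : ℝ)| * |a|))).const_mul |a|).const_mul (2 * Real.pi))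
    simpa [δ] using this
  have hfin : ∀ N, ‖∫ x in (0 : ℝ)..2 * Real.pi,
        Complex.exp (-Complex.I * m * x) * ((g 0 (Real.cos x) : ℝ) : ℂ)‖ ≤
      2 * Real.pi * (C * (1 / (1 - s / r) ^ (k + 1)) * Real.exp (m * a)) + δ N := by
    intro N
    rw [← hI0 N, sub_eq_iff_eq_add.1 (hrect N)]
    refine (norm_add_le _ _).trans ?_
    linarith [htop N, hrem N]
  refine ge_of_tendsto' (x := Filter.atTop) ?_ hfin
  simpa using hδ.const_add (2 * Real.pi * (C * (1 / (1 - s / r) ^ (k + 1)) * Real.exp (m * a)))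

lemma IsAnalyticJet.norm_fourier_integral_le {g : ℕ → ℝ → ℝ} {C r : ℝ} {k : ℕ}
    (hg : IsAnalyticJet g C r k) (hC : 0 ≤ C) {a : ℝ} (ha : 0 ≤ a) (har : Real.sinh a < r) (m : ℤ) :
    ‖∫ x in (0 : ℝ)..2 * Real.pi,
        Complex.exp (-Complex.I * m * x) * ((g 0 (Real.cos x) : ℝ) : ℂ)‖ ≤
      2 * Real.pi *
        (C * (1 / (1 - Real.sinh a / r) ^ (k + 1)) * Real.exp (-a) ^ m.natAbs) := by
  have hcast : ((m.natAbs : ℕ) : ℝ) = |(m : ℝ)| := by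
    rw [Nat.cast_natAbs, Int.cast_abs]
  rw [← Real.exp_nat_mul, hcast]
  rcases le_total 0 m with hm | hm
  · have hm' : (0 : ℝ) ≤ m := by exact_mod_cast hm
    have h := hg.norm_integral_le_of_shift hC (-a) (by rwa [abs_neg, abs_of_nonneg ha]) m
    rwa [abs_neg, abs_of_nonneg ha, ← abs_of_nonneg hm'] at h
  · have hm' : (m : ℝ) ≤ 0 := by exact_mod_cast hm
    have h := hg.norm_integral_le_of_shift hC a (by rwa [abs_of_nonneg ha]) m
    rwa [abs_of_nonneg ha, show (m : ℝ) * a = |(m : ℝ)| * -a by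
      rw [abs_of_nonpos hm']; ring] at h

/-- The Fourier-cosine expansion of `x ↦ g 0 (cos x)` with geometrically decaying
coefficients. -/
lemma IsAnalyticJet.exists_hasSum_cos {g : ℕ → ℝ → ℝ} {C r : ℝ} {k : ℕ}
    (hg : IsAnalyticJet g C r k) (hC : 0 ≤ C) {a : ℝ} (ha : 0 < a) (har : Real.sinh a < r) :
    ∃ b : ℤ → ℝ, (∀ m, |b m| ≤ C * (1 / (1 - Real.sinh a / r) ^ (k + 1)) *
        Real.exp (-a) ^ m.natAbs) ∧
      ∀ θ : ℝ, HasSum (fun m : ℤ => b m * Real.cos (m * θ)) (g 0 (Real.cos θ)) := by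
  have hpi : (0 : ℝ) < 2 * Real.pi := by positivity
  have : Fact (0 < 2 * Real.pi) := ⟨hpi⟩
  have hr : 0 < r := (Real.sinh_pos_iff.2 ha).trans har
  let f : C(AddCircle (2 * Real.pi), ℂ) :=
    ⟨fun θ => ((g 0 (Real.Angle.cos θ) : ℝ) : ℂ), Complex.continuous_ofReal.comp
      (ContinuousOn.comp_continuous (s := Set.Icc (-1) 1)
        (fun x hx => (hg.hasDeriv 0 x hx).continuousWithinAt)
        Real.Angle.continuous_cos fun θ => by
          induction θ using Real.Angle.induction_on with
          | h x => exact Real.cos_mem_Icc x)⟩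
  have hf : ∀ x : ℝ, f (x : AddCircle (2 * Real.pi)) = ((g 0 (Real.cos x) : ℝ) : ℂ) :=
    fun x => rfl
  have hfour : ∀ (m : ℤ) (x : ℝ), fourier m (x : AddCircle (2 * Real.pi)) =
      Complex.exp (Complex.I * m * x) := by
    intro m x
    rw [fourier_coe_apply]
    congr 1
    have : (Real.pi : ℂ) ≠ 0 := by exact_mod_cast Real.pi_ne_zero
    push_cast
    field_simp
  have hcoef : ∀ m, ‖fourierCoeff f m‖ ≤ C * (1 / (1 - Real.sinh a / r) ^ (k + 1)) *
        Real.exp (-a) ^ m.natAbs := by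
    intro m
    rw [fourierCoeff_eq_intervalIntegral f m 0, zero_add]
    have h : ∀ x : ℝ, fourier (-m) (x : AddCircle (2 * Real.pi)) •
        f (x : AddCircle (2 * Real.pi)) =
        Complex.exp (-Complex.I * m * x) * ((g 0 (Real.cos x) : ℝ) : ℂ) := by
      intro x
      rw [hfour, hf, smul_eq_mul]
      push_cast
      ring_nf
    simp only [h]
    rw [norm_smul, Real.norm_of_nonneg (by positivity), one_div, inv_mul_le_iff₀ hpi]
    exact hg.norm_fourier_integral_le hC ha.le har m
  have hgeo : Summable fun n : ℕ => C * (1 / (1 - Real.sinh a / r) ^ (k + 1)) *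
      Real.exp (-a) ^ n :=
    (summable_geometric_of_lt_one (Real.exp_pos _).le
      (Real.exp_lt_one_iff.2 (by linarith))).mul_left _
  have hsum : Summable (fourierCoeff f) := by
    refine Summable.of_norm_bounded
      (g := fun m : ℤ => C * (1 / (1 - Real.sinh a / r) ^ (k + 1)) * Real.exp (-a) ^ m.natAbs)
      ?_ hcoef
    refine Summable.of_nat_of_neg ?_ ?_ <;> simpa using hgeo
  refine ⟨fun m => (fourierCoeff f m).re, fun m => (Complex.abs_re_le_norm _).trans (hcoef m),
    fun θ => ?_⟩
  have h1 := has_pointwise_sum_fourier_series_of_summable hsum (θ : AddCircle (2 * Real.pi))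
  have h2 := has_pointwise_sum_fourier_series_of_summable hsum ((-θ : ℝ) : AddCircle (2 * Real.pi))
  simp only [hf, hfour, Real.cos_neg] at h1 h2
  have h3 := Complex.hasSum_re ((h1.add h2).mul_left (1 / 2))
  convert h3 using 1
  · funext m
    have h4 : Complex.exp (Complex.I * m * θ) + Complex.exp (Complex.I * m * (-θ : ℝ)) =
        2 * ((Real.cos (m * θ) : ℝ) : ℂ) := by
      push_cast
      rw [Complex.two_cos]
      ring_nf
    rw [smul_eq_mul, smul_eq_mul, ← mul_add, h4,
      show (1 / 2 : ℂ) * (fourierCoeff f m * (2 * ((Real.cos (m * θ) : ℝ) : ℂ))) =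
        fourierCoeff f m * ((Real.cos (m * θ) : ℝ) : ℂ) by ring, Complex.re_mul_ofReal]
  · rw [← two_mul, ← mul_assoc]
    norm_num

/-- Polynomial approximation at a geometric rate (Bernstein). -/
lemma IsAnalyticJet.exists_polynomial {g : ℕ → ℝ → ℝ} {C r : ℝ} {k : ℕ}
    (hg : IsAnalyticJet g C r k) (hC : 0 ≤ C) {a : ℝ} (ha : 0 < a) (har : Real.sinh a < r)
    {p : ℕ} (hp : 1 ≤ p) :
    ∃ q : Polynomial ℝ, q.degree < p ∧ ∀ x ∈ Set.Icc (-1 : ℝ) 1, |g 0 x - q.eval x| ≤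
      2 * (C * (1 / (1 - Real.sinh a / r) ^ (k + 1))) * Real.exp (-a) ^ p *
        (1 - Real.exp (-a))⁻¹ := by
  obtain ⟨b, hb, hsum⟩ := hg.exists_hasSum_cos hC ha har
  obtain ⟨A, hA⟩ : ∃ A, A = C * (1 / (1 - Real.sinh a / r) ^ (k + 1)) := ⟨_, rfl⟩
  rw [← hA] at hb ⊢
  have hw : Real.exp (-a) < 1 := Real.exp_lt_one_iff.2 (by linarith)
  have hp0 : (0 : WithBot ℕ) < p := by exact_mod_cast hp
  refine ⟨∑ n ∈ range p, Polynomial.C (b n + b (-n)) * Polynomial.Chebyshev.T ℝ n -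
    Polynomial.C (b 0), ?_, ?_⟩
  · refine (Polynomial.degree_sub_le _ _).trans_lt (max_lt ?_ ?_)
    · refine (Polynomial.degree_sum_le _ _).trans_lt ?_
      refine (Finset.sup_lt_iff (WithBot.bot_lt_coe p)).2 fun n hn => ?_
      rw [← Polynomial.smul_eq_C_mul]
      refine (Polynomial.degree_smul_le _ _).trans_lt ?_
      rw [Polynomial.Chebyshev.degree_T, Int.natAbs_natCast]
      exact WithBot.coe_lt_coe.2 (mem_range.1 hn)
    · exact Polynomial.degree_C_le.trans_lt hp0
  · intro x hx
    obtain ⟨θ, rfl⟩ : ∃ θ, Real.cos θ = x := ⟨Real.arccos x, Real.cos_arccos hx.1 hx.2⟩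
    have h1 := (hsum θ).nat_add_neg
    have h2 : ∀ n : ℕ, b n * Real.cos ((n : ℤ) * θ) + b (-n) * Real.cos ((-n : ℤ) * θ) =
        (b n + b (-n)) * Real.cos (n * θ) := by
      intro n
      push_cast
      rw [neg_mul, Real.cos_neg]
      ring
    simp only [h2] at h1
    have h3 := (hasSum_nat_add_iff' p).2 h1
    have h4 : g 0 (Real.cos θ) - Polynomial.eval (Real.cos θ)
        (∑ n ∈ range p, Polynomial.C (b n + b (-n)) * Polynomial.Chebyshev.T ℝ n -
          Polynomial.C (b 0)) =
        g 0 (Real.cos θ) + b 0 * Real.cos ((0 : ℤ) * θ) -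
          ∑ n ∈ range p, (b n + b (-n)) * Real.cos (n * θ) := by
      simp only [Polynomial.eval_sub, Polynomial.eval_finsetSum, Polynomial.eval_mul,
        Polynomial.eval_C, Polynomial.Chebyshev.T_real_cos, Int.cast_natCast]
      simp
      ring
    rw [h4, ← h3.tsum_eq, ← Real.norm_eq_abs]
    have hgeo := (hasSum_geometric_of_lt_one (Real.exp_pos (-a)).le hw).mul_left
      (2 * A * Real.exp (-a) ^ p)
    refine tsum_of_norm_bounded hgeo fun n => ?_
    rw [norm_mul, Real.norm_eq_abs, Real.norm_eq_abs]
    have h5 := hb ((n + p : ℕ) : ℤ)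
    have h6 := hb (-((n + p : ℕ) : ℤ))
    rw [Int.natAbs_neg] at h6
    rw [Int.natAbs_natCast] at h5 h6
    calc |b ((n + p : ℕ) : ℤ) + b (-((n + p : ℕ) : ℤ))| * |Real.cos ((n + p : ℕ) * θ)|
        ≤ |b ((n + p : ℕ) : ℤ) + b (-((n + p : ℕ) : ℤ))| * 1 :=
          mul_le_mul_of_nonneg_left (Real.abs_cos_le_one _) (abs_nonneg _)
      _ ≤ 2 * A * Real.exp (-a) ^ p * Real.exp (-a) ^ n := by
          rw [mul_one, mul_assoc (2 * A), ← pow_add, add_comm p n]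
          linarith [abs_add_le (b ((n + p : ℕ) : ℤ)) (b (-((n + p : ℕ) : ℤ)))]

lemma varsigma_pos {r : ℝ} (hr : 0 < r) : 0 < varsigma r := by
  unfold varsigma; positivity

/-- The approximation error for the choice of ellipse `sinh a = r p / (p + 1)`. -/
lemma IsAnalyticJet.exists_polynomial_varsigma {g : ℕ → ℝ → ℝ} {C r : ℝ} {k : ℕ}
    (hg : IsAnalyticJet g C r k) (hC : 0 ≤ C) (hr : 0 < r) {p : ℕ} (hp : 1 ≤ p) :
    ∃ q : Polynomial ℝ, q.degree < p ∧ ∀ x ∈ Set.Icc (-1 : ℝ) 1, |g 0 x - q.eval x| ≤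
      2 * Real.exp 1 * C * ((p : ℝ) + 1) ^ (k + 1) * (1 + 2 / r) * (varsigma r)⁻¹ ^ p := by
  have hp1 : (1 : ℝ) ≤ p := by exact_mod_cast hp
  obtain ⟨u, hu⟩ : ∃ u : ℝ, u = p / (p + 1) := ⟨_, rfl⟩
  have hu0 : 0 < u := by rw [hu]; positivity
  have hu1 : u < 1 := by rw [hu, div_lt_one (by positivity)]; linarith
  have hu2 : 1 / 2 ≤ u := by rw [hu, div_le_div_iff₀ (by norm_num) (by positivity)]; linarith
  have hsr : Real.sinh (Real.arsinh (r * u)) < r := by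
    rw [Real.sinh_arsinh]; nlinarith
  obtain ⟨q, hq, h⟩ := hg.exists_polynomial hC (Real.arsinh_pos_iff.2 (mul_pos hr hu0)) hsr hp
  refine ⟨q, hq, fun x hx => (h x hx).trans ?_⟩
  rw [Real.sinh_arsinh, Real.exp_neg, Real.exp_arsinh]
  obtain ⟨ρ, hρ⟩ : ∃ ρ, ρ = r * u + √(1 + (r * u) ^ 2) := ⟨_, rfl⟩
  rw [← hρ]
  have hς := varsigma_pos hr
  have hρς : varsigma r * u ≤ ρ := by
    have : √(1 + r ^ 2) * u ≤ √(1 + (r * u) ^ 2) := by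
      refine Real.le_sqrt_of_sq_le ?_
      rw [mul_pow, Real.sq_sqrt (by positivity), mul_pow]
      nlinarith
    rw [hρ, varsigma]
    nlinarith
  have hρ1 : 1 + r / 2 ≤ ρ := by
    have : 1 ≤ √(1 + (r * u) ^ 2) := Real.one_le_sqrt.2 (by nlinarith [sq_nonneg (r * u)])
    rw [hρ]
    nlinarith
  have hρ0 : 0 < ρ := by linarith
  have e1 : 1 / (1 - r * u / r) ^ (k + 1) = ((p : ℝ) + 1) ^ (k + 1) := by
    have : 1 - r * u / r = ((p : ℝ) + 1)⁻¹ := by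
      rw [mul_div_cancel_left₀ _ hr.ne', hu]
      field_simp
      ring
    rw [this, inv_pow, one_div, inv_inv]
  have e2 : ρ⁻¹ ^ p ≤ Real.exp 1 * (varsigma r)⁻¹ ^ p := by
    have h1 : ρ⁻¹ ≤ (varsigma r)⁻¹ * u⁻¹ := by
      rw [← mul_inv]
      exact inv_anti₀ (mul_pos hς hu0) hρς
    have h2 : u⁻¹ ^ p ≤ Real.exp 1 := by
      have h3 : u⁻¹ ≤ Real.exp (1 / p) := by
        have : u⁻¹ = 1 / p + 1 := by rw [hu]; field_simp; ring
        rw [this]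
        exact Real.add_one_le_exp _
      refine (pow_le_pow_left₀ (by positivity) h3 p).trans_eq ?_
      rw [← Real.exp_nat_mul]
      congr 1
      field_simp
    calc ρ⁻¹ ^ p ≤ ((varsigma r)⁻¹ * u⁻¹) ^ p := pow_le_pow_left₀ (by positivity) h1 p
      _ = u⁻¹ ^ p * (varsigma r)⁻¹ ^ p := by rw [mul_pow]; ring
      _ ≤ _ := by gcongr
  have e3 : (1 - ρ⁻¹)⁻¹ ≤ 1 + 2 / r := by
    have h1 : 0 < ρ - 1 := by linarith
    have : (1 - ρ⁻¹)⁻¹ = 1 + 1 / (ρ - 1) := by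
      have : 1 - ρ⁻¹ = (ρ - 1) / ρ := by field_simp
      rw [this, inv_div]
      field_simp
      ring
    rw [this]
    have h2 : 1 / (ρ - 1) ≤ 2 / r := by
      rw [div_le_div_iff₀ h1 hr]
      linarith
    linarith
  have e4 : 0 ≤ (1 - ρ⁻¹)⁻¹ := by
    rw [inv_nonneg, sub_nonneg]
    exact inv_le_one_of_one_le₀ (by linarith)
  rw [e1]
  calc 2 * (C * ((p : ℝ) + 1) ^ (k + 1)) * ρ⁻¹ ^ p * (1 - ρ⁻¹)⁻¹
      ≤ 2 * (C * ((p : ℝ) + 1) ^ (k + 1)) * (Real.exp 1 * (varsigma r)⁻¹ ^ p) * (1 + 2 / r) := by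
        gcongr
    _ = _ := by ring

/-- The affine map of `[-1, 1]` onto `[α, β]`. -/
noncomputable def affineIcc (α β x : ℝ) : ℝ := ((α - β) / 2) * x + (α + β) / 2

lemma affineIcc_mem {α β x : ℝ} (hab : α ≤ β) (hx : x ∈ Set.Icc (-1 : ℝ) 1) :
    affineIcc α β x ∈ Set.Icc α β := by
  obtain ⟨h1, h2⟩ := hx
  constructor <;> unfold affineIcc <;> nlinarith

lemma isAnalyticJet_affineIcc {h : ℝ → ℝ} {α β : ℝ} (hab : α < β)
    (hh : ContDiffOn ℝ (⊤ : ℕ∞) h (Set.Icc α β)) {C γ diam : ℝ} (hγ : 0 < γ)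
    (hdiam : β - α ≤ diam) {k : ℕ}
    (hb : ∀ t ∈ Set.Ioo α β, ∀ v : ℕ, |iteratedDeriv v h t| ≤
      C * ((v + k).factorial : ℝ) / (γ ^ v * (k.factorial : ℝ))) :
    IsAnalyticJet (fun v x => ((α - β) / 2) ^ v *
      iteratedDerivWithin v h (Set.Icc α β) (affineIcc α β x)) C (2 * γ / diam) k := by
  have hd : 0 < diam := by linarith
  have hu : UniqueDiffOn ℝ (Set.Icc α β) := uniqueDiffOn_Icc hab
  have hdiff : ∀ v, DifferentiableOn ℝ (iteratedDerivWithin v h (Set.Icc α β)) (Set.Icc α β) :=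
    fun v => hh.differentiableOn_iteratedDerivWithin (by exact_mod_cast ENat.natCast_lt_top v) hu
  refine ⟨fun v x hx => ?_, fun v x hx => ?_⟩
  · have h1 := (hdiff v _ (affineIcc_mem hab.le hx)).hasDerivWithinAt
    rw [← iteratedDerivWithin_succ] at h1
    have h2 : HasDerivWithinAt (affineIcc α β) ((α - β) / 2) (Set.Icc (-1) 1) x := by
      have := (((hasDerivAt_id x).const_mul ((α - β) / 2)).add_const ((α + β) / 2)).hasDerivWithinAt
        (s := Set.Icc (-1 : ℝ) 1)
      exact this.congr_deriv (mul_one _)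
    have h3 := (h1.comp x h2 fun y hy => affineIcc_mem hab.le hy).const_mul (((α - β) / 2) ^ v)
    refine h3.congr_deriv ?_
    ring
  · have hbd : ∀ t ∈ Set.Icc α β, |iteratedDerivWithin v h (Set.Icc α β) t| ≤
        C * ((v + k).factorial : ℝ) / (γ ^ v * (k.factorial : ℝ)) := by
      have hcl : closure (Set.Ioo α β) = Set.Icc α β := closure_Ioo hab.ne
      intro t ht
      rw [← hcl] at ht
      refine le_on_closure (f := fun t => |iteratedDerivWithin v h (Set.Icc α β) t|)
        (s := Set.Ioo α β) (fun t ht => ?_) ?_ continuousOn_const ht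
      · have h1 : iteratedDerivWithin v h (Set.Icc α β) t = iteratedDeriv v h t := by
          rw [iteratedDerivWithin, iteratedFDerivWithin_congr_set (t := Set.univ)
            (Filter.eventuallyEq_univ.2 (Icc_mem_nhds ht.1 ht.2)), iteratedFDerivWithin_univ]
          rfl
        simpa only [h1] using hb t ht v
      · rw [hcl]
        exact (hdiff v).continuousOn.abs
    have hfac : ((v + k).factorial : ℝ) = (v + k).choose k * v.factorial * k.factorial := by
      have := Nat.choose_mul_factorial_mul_factorial (Nat.le_add_left k v)
      rw [Nat.add_sub_cancel] at this
      rw [← this]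
      push_cast
      ring
    rw [abs_mul, abs_pow, abs_div, abs_of_neg (by linarith : α - β < 0), abs_two]
    have hk : (0 : ℝ) < k.factorial := by exact_mod_cast k.factorial_pos
    calc (-(α - β) / 2) ^ v * |iteratedDerivWithin v h (Set.Icc α β) (affineIcc α β x)|
        ≤ (diam / 2) ^ v * (C * ((v + k).factorial : ℝ) / (γ ^ v * (k.factorial : ℝ))) := by
          gcongr
          · linarith
          · linarith
          · exact hbd _ (affineIcc_mem hab.le hx)
      _ = _ := by
          rw [hfac, div_pow, div_pow, mul_pow]
          field_simp

/-- Mode-wise interpolation errors add up to an error for the full contraction. -/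
lemma abs_sub_tuckerContract_le {n p D : ℕ} {U : ℕ → Fin n → ℕ → ℝ} {i : ℕ → Fin n}
    {T : (ℕ → ℕ) → ℝ} {F : ℕ → (ℕ → ℕ) → ℝ} {Λ ε : ℝ} (hΛ : 0 ≤ Λ) (hε : 0 ≤ ε)
    (hU : ∀ k, ∑ j ∈ range p, |U k (i k) j| ≤ Λ) (hT : ∀ x, F D x = T x)
    (hF : ∀ k < D, ∀ x, |F k x - ∑ j ∈ range p, U k (i k) j *
      F (k + 1) (Function.update x k j)| ≤ (Λ + 1) * ε) (m k : ℕ) (hk : k + m = D) (x : ℕ → ℕ) :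
    |F k x - tuckerContract p U i T m k x| ≤ m * (Λ + 1) ^ m * ε := by
  induction m generalizing k x with
  | zero =>
    obtain rfl : k = D := hk
    simp [tuckerContract, hT]
  | succ m ih =>
    have h1 := hF k (by omega) x
    have h2 : |∑ j ∈ range p, U k (i k) j * (F (k + 1) (Function.update x k j) -
        tuckerContract p U i T m (k + 1) (Function.update x k j))| ≤
        Λ * (m * (Λ + 1) ^ m * ε) := by
      refine (abs_sum_le_sum_abs _ _).trans ?_
      refine le_trans ?_ (mul_le_mul_of_nonneg_right (hU k) (by positivity))
      rw [sum_mul]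
      refine sum_le_sum fun j _ => ?_
      rw [abs_mul]
      exact mul_le_mul_of_nonneg_left (ih (k + 1) (by omega) _) (abs_nonneg _)
    have h3 : F k x - tuckerContract p U i T (m + 1) k x =
        (F k x - ∑ j ∈ range p, U k (i k) j * F (k + 1) (Function.update x k j)) +
        ∑ j ∈ range p, U k (i k) j * (F (k + 1) (Function.update x k j) -
          tuckerContract p U i T m (k + 1) (Function.update x k j)) := by
      simp only [tuckerContract, mul_sub, sum_sub_distrib]
      ring
    rw [h3]
    refine (abs_add_le _ _).trans ((add_le_add h1 h2).trans ?_)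
    have h4 : (1 : ℝ) ≤ (Λ + 1) ^ m := one_le_pow₀ (by linarith)
    have h5 : (Λ + 1) * ε * 1 ≤ (Λ + 1) * ε * (Λ + 1) ^ m :=
      mul_le_mul_of_nonneg_left h4 (by positivity)
    have h6 : 0 ≤ m * (Λ + 1) ^ m * ε := by positivity
    push_cast
    rw [pow_succ]
    nlinarith

/-- The grid point whose first `k` coordinates are the degree-`p` nodes selected by `x` and whose
other coordinates are the degree-`n` nodes selected by `i`. -/
noncomputable def mixedNode {D n : ℕ} (α β : Fin D → ℝ) (p : ℕ) (i : ℕ → Fin n) (k : ℕ)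
    (x : ℕ → ℕ) (d : Fin D) : ℝ :=
  affineIcc (α d) (β d) (if (d : ℕ) < k then chebNodeNat p (x d) else chebNode n (i d))

lemma chebNode_mem {n : ℕ} (j : Fin n) : chebNode n j ∈ Set.Icc (-1 : ℝ) 1 :=
  Real.cos_mem_Icc _

lemma mixedNode_mem {D n : ℕ} {α β : Fin D → ℝ} (hab : ∀ d, α d < β d) (p : ℕ) (i : ℕ → Fin n)
    (k : ℕ) (x : ℕ → ℕ) (d : Fin D) : mixedNode α β p i k x d ∈ Set.Icc (α d) (β d) := by
  refine affineIcc_mem (hab d).le ?_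
  split_ifs
  · exact chebNodeNat_mem p _
  · exact chebNode_mem _

lemma mixedNode_eq_update {D n : ℕ} (α β : Fin D → ℝ) (p : ℕ) (i : ℕ → Fin n) {k : ℕ}
    (hk : k < D) (x : ℕ → ℕ) :
    mixedNode α β p i k x = Function.update (mixedNode α β p i k x) ⟨k, hk⟩
      (affineIcc (α ⟨k, hk⟩) (β ⟨k, hk⟩) (chebNode n (i k))) := by
  rw [eq_comm, Function.update_eq_self_iff]
  simp [mixedNode]

lemma mixedNode_succ_update {D n : ℕ} (α β : Fin D → ℝ) (p : ℕ) (i : ℕ → Fin n) {k : ℕ}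
    (hk : k < D) (x : ℕ → ℕ) (j : ℕ) :
    mixedNode α β p i (k + 1) (Function.update x k j) =
      Function.update (mixedNode α β p i k x) ⟨k, hk⟩
        (affineIcc (α ⟨k, hk⟩) (β ⟨k, hk⟩) (chebNodeNat p j)) := by
  funext d
  rcases eq_or_ne d ⟨k, hk⟩ with rfl | hd
  · simp [mixedNode]
  · have hd' : (d : ℕ) ≠ k := fun h => hd (Fin.ext h)
    have : (d : ℕ) < k + 1 ↔ (d : ℕ) < k := by omega
    simp [mixedNode, hd, hd', this]

/-- One-dimensional interpolation error along a coordinate slice. -/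
lemma abs_slice_sub_interpolate_le {D : ℕ} {α β : Fin D → ℝ} (hab : ∀ i, α i < β i)
    {f : (Fin D → ℝ) → ℝ}
    (hf : ContDiffOn ℝ (⊤ : ℕ∞) f (Set.univ.pi fun i => Set.Icc (α i) (β i)))
    {C γ diam : ℝ} (hC : 0 ≤ C) (hγ : 0 < γ) {k : ℕ}
    (hderiv : ∀ x ∈ (Set.univ.pi fun i => Set.Icc (α i) (β i)), ∀ i : Fin D, ∀ v : ℕ,
      |iteratedDeriv v (fun t => f (Function.update x i t)) (x i)| ≤
        C * ((v + k).factorial : ℝ) / (γ ^ v * (k.factorial : ℝ)))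
    (hdiam : ∀ d, β d - α d ≤ diam) {p : ℕ} (hp : 1 ≤ p)
    {x : Fin D → ℝ} (hx : x ∈ Set.univ.pi fun i => Set.Icc (α i) (β i)) (d : Fin D)
    {t : ℝ} (ht : t ∈ Set.Icc (-1 : ℝ) 1) :
    |f (Function.update x d (affineIcc (α d) (β d) t)) - ∑ j ∈ range p, (chebBasis p j).eval t *
      f (Function.update x d (affineIcc (α d) (β d) (chebNodeNat p j)))| ≤
    (lebesgueConst p + 1) * (2 * Real.exp 1 * C * ((p : ℝ) + 1) ^ (k + 1) *
      (1 + 2 / (2 * γ / diam)) * (varsigma (2 * γ / diam))⁻¹ ^ p) := by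
  have hd : 0 < diam := by linarith [hab d, hdiam d]
  have hmem : ∀ s ∈ Set.Icc (α d) (β d),
      Function.update x d s ∈ Set.univ.pi fun i => Set.Icc (α i) (β i) := by
    intro s hs e _
    rcases eq_or_ne e d with rfl | he
    · simpa using hs
    · simpa [he] using hx e (Set.mem_univ e)
  have hsm : ContDiffOn ℝ (⊤ : ℕ∞) (fun s => f (Function.update x d s))
      (Set.Icc (α d) (β d)) :=
    hf.comp (contDiff_update _ x d).contDiffOn hmem
  have hjet := isAnalyticJet_affineIcc (hab d) hsm hγ (hdiam d) (k := k) fun s hs v => by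
    have := hderiv _ (hmem s (Set.Ioo_subset_Icc_self hs)) d v
    simpa using this
  obtain ⟨q, hq, h⟩ := hjet.exists_polynomial_varsigma hC (by positivity) hp
  have := abs_sub_chebInterpolate_le p _ q hq h ht
  simpa using this

/-- Proposition 3.2 of the paper: the tensor of Chebyshev samples of a smooth
function with the stated derivative bound admits, for every `1 ≤ p ≤ n`, a
tensor-train decomposition with TT-ranks `r_k ≤ min{p^k, p^{D−k}}` whose error
in the Chebyshev norm is at most `E(p)` when `p < n`, and which is exact when
`p = n`. -/
theorem tt_approximation_of_cheb_tensor (D n : ℕ) (hD : 2 ≤ D) (hn : 1 ≤ n)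
    (α β : Fin D → ℝ) (hab : ∀ i, α i < β i)
    (f : (Fin D → ℝ) → ℝ)
    (hf : ContDiffOn ℝ (⊤ : ℕ∞) f (Set.univ.pi fun i => Set.Icc (α i) (β i)))
    (Cf γf : ℝ) (hCf : 0 ≤ Cf) (hγf : 0 < γf) (σ : ℕ) (hσ : 1 ≤ σ)
    (hderiv : ∀ x ∈ (Set.univ.pi fun i => Set.Icc (α i) (β i)), ∀ i : Fin D, ∀ v : ℕ,
      |iteratedDeriv v (fun t => f (Function.update x i t)) (x i)| ≤
        Cf * (Nat.factorial (v + σ - 1) : ℝ) / (γf ^ v * (Nat.factorial (σ - 1) : ℝ)))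
    (M : (Fin D → Fin n) → ℝ)
    (hM : ∀ i, M i = f (fun j => scaledChebNode n (α j) (β j) (i j)))
    (p : ℕ) (hp1 : 1 ≤ p) (hpn : p ≤ n) :
    ∃ r : ℕ → ℕ, r 0 = 1 ∧ r D = 1 ∧
      (∀ k, 1 ≤ k → k ≤ D - 1 → r k ≤ min (p ^ k) (p ^ (D - k))) ∧
      ∃ G : ∀ k : ℕ, Fin (r k) → Fin n → Fin (r (k + 1)) → ℝ,
        (p < n →
          (⨆ i : Fin D → Fin n,
            |M i - ttEntry r G D (fun k => if h : k < D then i ⟨k, h⟩ else (⟨0, hn⟩ : Fin n))|) ≤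
            Equant D Cf γf (⨆ i : Fin D, (β i - α i)) σ p) ∧
        (p = n → ∀ i : Fin D → Fin n,
          ttEntry r G D (fun k => if h : k < D then i ⟨k, h⟩ else (⟨0, hn⟩ : Fin n)) = M i) := by
  obtain ⟨r, hr0, hrD, hr, G, hG⟩ := exists_tt_of_tucker D p hD hp1
    (fun _ (a : Fin n) j => (chebBasis p j).eval (chebNode n a))
    (fun x => f fun d : Fin D => affineIcc (α d) (β d) (chebNodeNat p (x d)))
  refine ⟨r, hr0, hrD, hr, G, ?_⟩
  have hMi : ∀ i : Fin D → Fin n, M i = f (mixedNode α β p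
      (fun k => if h : k < D then i ⟨k, h⟩ else (⟨0, hn⟩ : Fin n)) 0 0) := by
    intro i
    rw [hM]
    congr 1
    funext d
    simp [mixedNode, scaledChebNode, affineIcc]
  have herr : ∀ ε : ℝ, 0 ≤ ε → ∀ i : Fin D → Fin n,
      (∀ k (hk : k < D) x, x ∈ Set.univ.pi (fun i => Set.Icc (α i) (β i)) → ∀ a : Fin n,
        |f (Function.update x ⟨k, hk⟩ (affineIcc (α ⟨k, hk⟩) (β ⟨k, hk⟩) (chebNode n a))) -
          ∑ j ∈ range p, (chebBasis p j).eval (chebNode n a) *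
          f (Function.update x ⟨k, hk⟩ (affineIcc (α ⟨k, hk⟩) (β ⟨k, hk⟩) (chebNodeNat p j)))| ≤
        (lebesgueConst p + 1) * ε) →
      |M i - ttEntry r G D (fun k => if h : k < D then i ⟨k, h⟩ else (⟨0, hn⟩ : Fin n))| ≤
        D * (lebesgueConst p + 1) ^ D * ε := by
    intro ε hε i h
    obtain ⟨i', hi'⟩ : ∃ i' : ℕ → Fin n,
        i' = fun k => if h : k < D then i ⟨k, h⟩ else (⟨0, hn⟩ : Fin n) := ⟨_, rfl⟩
    rw [hMi, hG, ← hi']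
    refine abs_sub_tuckerContract_le (F := fun k x => f (mixedNode α β p i' k x))
      (lebesgueConst_nonneg p) hε (fun k => sum_abs_eval_chebBasis_le p (chebNode_mem _))
      (fun x => ?_) (fun k hk x => ?_) D 0 (zero_add D) 0
    · congr 1
      funext d
      simp [mixedNode]
    · have h1 := h k hk _ (fun d _ => mixedNode_mem hab p i' k x d) (i' k)
      rw [← mixedNode_eq_update α β p i' hk x] at h1
      simpa only [mixedNode_succ_update α β p i' hk] using h1
  refine ⟨fun _ => ?_, ?_⟩
  · have : Nonempty (Fin n) := ⟨⟨0, hn⟩⟩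
    obtain ⟨k, rfl⟩ : ∃ k, σ = k + 1 := ⟨σ - 1, by omega⟩
    have hdiam : ∀ d, β d - α d ≤ ⨆ i : Fin D, (β i - α i) := fun d =>
      le_ciSup (f := fun i : Fin D => β i - α i) (Set.finite_range _).bddAbove d
    have hd0 : 0 < ⨆ i : Fin D, (β i - α i) :=
      (sub_pos.2 (hab ⟨0, by omega⟩)).trans_le (hdiam _)
    have hς := varsigma_pos (r := 2 * γf / ⨆ i : Fin D, (β i - α i)) (by positivity)
    refine ciSup_le fun i => (herr _ (by positivity) i fun k' hk x hx a =>
      abs_slice_sub_interpolate_le hab hf hCf hγf (k := k) hderiv hdiam hp1 hx _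
        (chebNode_mem a)).trans_eq ?_
    rw [Equant]
    have : 2 / (2 * γf / ⨆ i : Fin D, (β i - α i)) = (⨆ i : Fin D, (β i - α i)) / γf := by
      field_simp
    rw [this]
    ring
  · rintro rfl i
    have h := herr 0 le_rfl i fun k hk x _ a => by
      have hnode : ∀ j : Fin p, chebNode p j = chebNodeNat p j := fun j => rfl
      rw [sum_eq_single_of_mem (a : ℕ) (by simp)]
      · rw [hnode, eval_chebBasis_chebNodeNat a.2 a.2]
        simp
      · intro j hj hja
        rw [hnode, eval_chebBasis_chebNodeNat a.2 (by simpa using hj), if_neg hja, zero_mul]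
    rw [mul_zero] at h
    exact (sub_eq_zero.1 (abs_nonpos_iff.1 h)).symm
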